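/- arXiv:2103.10204 — 5 statements merged into one kernel-verified Lean document; each statement's English description precedes it below -/
import Mathlib

section
/- Fix θ ∈ ℝ and p ∈ [-1,1]. For every g ∈ M, the left translation x ↦ g ·_p x and the right translation x ↦ x ·_p g both preserve Lebesgue measure (volume) on ℝ × ℂ × ℂ. Hence Lebesgue measure is simultaneously a left and right Haar measure for every group M_p, i.e. the variable Mautner group is unimodular. -/
noncomputable section

open MeasureTheory

/-- The multiplication of the variable Mautner group `M_p`. -/
def vmul (θ p : ℝ) (x y : ℝ × ℂ × ℂ) : ℝ × ℂ × ℂ :=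
  (x.1 + y.1,
   Complex.exp (((p : ℂ) + Complex.I) * (y.1 : ℂ)) * x.2.1 + y.2.1,
   Complex.exp ((-(p : ℂ) + Complex.I * (θ : ℂ)) * (y.1 : ℂ)) * x.2.2 + y.2.2)

instance isAddHaarMeasure_volume_complex_prod :
    (volume : Measure (ℂ × ℂ)).IsAddHaarMeasure :=
  Measure.prod.instIsAddHaarMeasure volume volume

theorem measurePreserving_mul_prod_mul {a b : ℂ} (h : ‖a‖ * ‖b‖ = 1) :
    MeasurePreserving (fun x : ℂ × ℂ => (a * x.1, b * x.2))
      (volume : Measure (ℂ × ℂ)) volume := by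
  have : LinearMap.det ((LinearMap.mulLeft ℝ a).prodMap (LinearMap.mulLeft ℝ b)) = 1 := by
    have hdet (c : ℂ) : LinearMap.det (LinearMap.mulLeft ℝ c) = ‖c‖ ^ 2 := by
      rw [← Complex.normSq_eq_norm_sq, ← Algebra.norm_complex_apply, Algebra.norm_apply]
      rfl
    rw [LinearMap.det_prodMap, hdet, hdet, ← mul_pow, h, one_pow]
  refine ⟨by fun_prop, ?_⟩
  have hmap := Measure.map_linearMap_addHaar_eq_smul_addHaar
    (volume : Measure (ℂ × ℂ))
    (f := (LinearMap.mulLeft ℝ a).prodMap (LinearMap.mulLeft ℝ b)) (by simp [this])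
  rwa [this, inv_one, abs_one, ENNReal.ofReal_one, one_smul] at hmap

theorem measurePreserving_vmul_left (θ p : ℝ) (g : ℝ × ℂ × ℂ) :
    MeasurePreserving (vmul θ p g) (volume : Measure (ℝ × ℂ × ℂ)) volume := by
  refine MeasurePreserving.skew_product
    (g := fun (t : ℝ) (x : ℂ × ℂ) =>
      (Complex.exp (((p : ℂ) + Complex.I) * (t : ℂ)) * g.2.1,
        Complex.exp ((-(p : ℂ) + Complex.I * (θ : ℂ)) * (t : ℂ)) * g.2.2) + x)
    (measurePreserving_add_left volume g.1) ?_ (.of_forall fun t => ?_)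
  · unfold Function.uncurry
    fun_prop
  · exact (measurePreserving_add_left (volume : Measure (ℂ × ℂ)) _).map_eq

theorem measurePreserving_vmul_right (θ p : ℝ) (g : ℝ × ℂ × ℂ) :
    MeasurePreserving (fun x => vmul θ p x g) (volume : Measure (ℝ × ℂ × ℂ)) volume := by
  have h : ‖Complex.exp (((p : ℂ) + Complex.I) * (g.1 : ℂ))‖ *
      ‖Complex.exp ((-(p : ℂ) + Complex.I * (θ : ℂ)) * (g.1 : ℂ))‖ = 1 := by
    simp [Complex.norm_exp, ← Real.exp_add]
  exact (measurePreserving_add_right volume g.1).prod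
    ((measurePreserving_add_right volume g.2).comp (measurePreserving_mul_prod_mul h))

/-- For every `g`, left and right translation by `g` in the group `M_p` preserve
Lebesgue measure on `ℝ × ℂ × ℂ`; i.e. Lebesgue measure is a left and right Haar
measure for every `M_p`, so the variable Mautner group is unimodular. -/
theorem stmt1 (θ p : ℝ) (hp : p ∈ Set.Icc (-1 : ℝ) 1) (g : ℝ × ℂ × ℂ) :
    MeasurePreserving (fun x : ℝ × ℂ × ℂ => vmul θ p g x)
      (volume : Measure (ℝ × ℂ × ℂ)) volume ∧
    MeasurePreserving (fun x : ℝ × ℂ × ℂ => vmul θ p x g)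
      (volume : Measure (ℝ × ℂ × ℂ)) volume :=
  ⟨measurePreserving_vmul_left θ p g, measurePreserving_vmul_right θ p g⟩

end
end

section
/- Fix θ ∈ ℝ, p ∈ [-1,1], ℓ ∈ ℂ². Let F : ℝ × ℂ² → ℂ be continuous with compact support and let ξ ∈ L²(ℝ). Then for almost every s ∈ ℝ both of the following integrals converge absolutely and are equal: ∫_{ℝ×ℂ²} F(t,c)·(π^p_ℓ(t,c)ξ)(s) dt dc = ∫_ℝ F̂²(s−t, t ⊙_p ℓ)·ξ(t) dt. That is, the operator π^p_ℓ(F) = ∫_M F(g) π^p_ℓ(g) dg is the integral operator on L²(ℝ) with kernel (s,t) ↦ F̂²(s−t, t ⊙_p ℓ). -/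
noncomputable section

open MeasureTheory

/-- The action `r ·_p c` of `ℝ` on `ℂ²`. -/
def act (θ p : ℝ) (r : ℝ) (c : ℂ × ℂ) : ℂ × ℂ :=
  (Complex.exp (((p : ℂ) + Complex.I) * (r : ℂ)) * c.1,
   Complex.exp ((-(p : ℂ) + Complex.I * (θ : ℂ)) * (r : ℂ)) * c.2)

/-- The dual action `r ⊙_p ℓ` of `ℝ` on `ℂ²`. -/
def dact (θ p : ℝ) (r : ℝ) (ℓ : ℂ × ℂ) : ℂ × ℂ :=
  (Complex.exp (((p : ℂ) - Complex.I) * (r : ℂ)) * ℓ.1,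
   Complex.exp ((-(p : ℂ) - Complex.I * (θ : ℂ)) * (r : ℂ)) * ℓ.2)

/-- The real pairing `⟨c,ℓ⟩ = Re(c₁ conj ℓ₁) + Re(c₂ conj ℓ₂)` on `ℂ²`. -/
def cpair (c ℓ : ℂ × ℂ) : ℝ :=
  (c.1 * (starRingEnd ℂ) ℓ.1).re + (c.2 * (starRingEnd ℂ) ℓ.2).re

/-- The partial Fourier transform `F̂²(u,ℓ) = ∫_{ℂ²} F(u,c) e^{i⟨c,ℓ⟩} dc`. -/
def pft (F : ℝ × ℂ × ℂ → ℂ) (u : ℝ) (ℓ : ℂ × ℂ) : ℂ :=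
  ∫ c : ℂ × ℂ, F (u, c) * Complex.exp (Complex.I * ((cpair c ℓ : ℝ) : ℂ))

/-- The pairing intertwines `act` and `dact`. -/
theorem cpair_act (θ p r : ℝ) (c ℓ : ℂ × ℂ) :
    cpair (act θ p r c) ℓ = cpair c (dact θ p r ℓ) := by
  have h₁ : (starRingEnd ℂ) (Complex.exp (((p : ℂ) - Complex.I) * (r : ℂ))) =
      Complex.exp (((p : ℂ) + Complex.I) * (r : ℂ)) := by
    rw [← Complex.exp_conj]
    simp
  have h₂ : (starRingEnd ℂ) (Complex.exp ((-(p : ℂ) - Complex.I * (θ : ℂ)) * (r : ℂ))) =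
      Complex.exp ((-(p : ℂ) + Complex.I * (θ : ℂ)) * (r : ℂ)) := by
    rw [← Complex.exp_conj]
    simp
  simp only [cpair, act, dact, map_mul, h₁, h₂]
  congr 2 <;> ring

theorem continuous_cpair_act (θ p s : ℝ) (ℓ : ℂ × ℂ) :
    Continuous fun m : ℝ × ℂ × ℂ => cpair (act θ p (s - m.1) m.2) ℓ := by
  unfold cpair act
  fun_prop

/-- A locally integrable function of the first variable is locally integrable on a product. -/
theorem locallyIntegrable_comp_fst {f : ℝ → ℂ} (hf : LocallyIntegrable f volume) :
    LocallyIntegrable (fun m : ℝ × ℂ × ℂ => f m.1) volume := by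
  rw [locallyIntegrable_iff]
  intro K hK
  have hK₁ := hK.image continuous_fst
  have hK₂ := hK.image continuous_snd
  refine IntegrableOn.mono_set (t := (Prod.fst '' K) ×ˢ (Prod.snd '' K)) ?_
    Set.subset_fst_image_prod_snd_image
  rw [IntegrableOn, Measure.volume_eq_prod, ← Measure.prod_restrict]
  have : IsFiniteMeasure ((volume : Measure (ℂ × ℂ)).restrict (Prod.snd '' K)) :=
    ⟨by simpa using hK₂.measure_lt_top⟩
  exact (hf.integrableOn_isCompact hK₁).comp_fst _

/-- For `F` continuous with compact support and `ξ ∈ L²(ℝ)`, for a.e. `s` the integrals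
`∫_{ℝ×ℂ²} F(t,c)(π^p_ℓ(t,c)ξ)(s) dt dc` and `∫_ℝ F̂²(s−t, t ⊙_p ℓ) ξ(t) dt` converge
absolutely and agree: `π^p_ℓ(F)` is the integral operator with kernel
`(s,t) ↦ F̂²(s−t, t ⊙_p ℓ)`. -/
theorem stmt3 (θ p : ℝ) (hp : p ∈ Set.Icc (-1 : ℝ) 1) (ℓ : ℂ × ℂ)
    (F : ℝ × ℂ × ℂ → ℂ) (hF : Continuous F) (hFs : HasCompactSupport F)
    (ξ : Lp ℂ 2 (volume : Measure ℝ)) :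
    ∀ᵐ s : ℝ ∂volume,
      Integrable (fun m : ℝ × ℂ × ℂ =>
        F m * (Complex.exp (Complex.I * ((cpair (act θ p (s - m.1) m.2) ℓ : ℝ) : ℂ)) *
          ξ (s - m.1))) volume ∧
      Integrable (fun t : ℝ => pft F (s - t) (dact θ p t ℓ) * ξ t) volume ∧
      ∫ m : ℝ × ℂ × ℂ,
          F m * (Complex.exp (Complex.I * ((cpair (act θ p (s - m.1) m.2) ℓ : ℝ) : ℂ)) *
            ξ (s - m.1)) =
        ∫ t : ℝ, pft F (s - t) (dact θ p t ℓ) * ξ t := by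
  refine Filter.Eventually.of_forall fun s => ?_
  have hξ : LocallyIntegrable ξ volume := (Lp.memLp ξ).locallyIntegrable one_le_two
  have hξs : LocallyIntegrable (fun t => ξ (s - t)) volume := by
    rw [locallyIntegrable_iff]
    intro K hK
    have h := hξ.integrableOn_isCompact
      (hK.image (continuous_const.sub continuous_id : Continuous fun t => s - t))
    exact ((volume.measurePreserving_sub_left s).integrableOn_image
      (MeasurableEquiv.subLeft s).measurableEmbedding).1 h
  have hint : Integrable (fun m : ℝ × ℂ × ℂ =>
      F m * (Complex.exp (Complex.I * ((cpair (act θ p (s - m.1) m.2) ℓ : ℝ) : ℂ)) *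
        ξ (s - m.1))) volume := by
    have hc := continuous_cpair_act θ p s ℓ
    have h := (locallyIntegrable_comp_fst hξs).integrable_smul_left_of_hasCompactSupport
      (g := fun m : ℝ × ℂ × ℂ =>
        F m * Complex.exp (Complex.I * ((cpair (act θ p (s - m.1) m.2) ℓ : ℝ) : ℂ)))
      (by fun_prop) hFs.mul_right
    simpa only [smul_eq_mul, mul_assoc] using h
  have hinner : ∀ u : ℝ, ∫ c : ℂ × ℂ,
      F (u, c) * (Complex.exp (Complex.I * ((cpair (act θ p (s - u) c) ℓ : ℝ) : ℂ)) *
        ξ (s - u)) = pft F u (dact θ p (s - u) ℓ) * ξ (s - u) := fun u => by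
    simp only [pft, ← cpair_act, ← integral_mul_const, mul_assoc]
  have hu : Integrable (fun u : ℝ => pft F u (dact θ p (s - u) ℓ) * ξ (s - u)) volume := by
    have h := hint
    rw [Measure.volume_eq_prod] at h
    simpa only [hinner] using h.integral_prod_left
  refine ⟨hint, by simpa only [sub_sub_cancel] using hu.comp_sub_left s, ?_⟩
  have h := hint
  rw [Measure.volume_eq_prod] at h ⊢
  rw [integral_prod _ h]
  simp only [hinner]
  rw [← integral_sub_left_eq_self _ volume s]
  simp only [sub_sub_cancel]

end
end

section
/- Fix θ ∈ ℝ and let f : ℝ × ℂ² → ℂ be smooth with compact support. Let δ ↦ ε(δ) and δ ↦ r(δ) be positive functions on (0,1] with lim_{δ→0} δ/ε(δ) = 0, lim_{δ→0} r(δ) = +∞ and lim_{δ→0} r(δ)·ε(δ) = 0. For δ ∈ (0,1], p ∈ [−1,1], ℓ = (ℓ₁,ℓ₂) ∈ ℂ² and j ∈ ℤ put R_j := j/ε(δ), I_j := [R_j, R_{j+1}), J_j := [R_j − r(δ), R_{j+1} + r(δ)], and let π_{p,ℓ} and σ_{δ,p,ℓ} be the bounded integral operators on L²(ℝ) with kernels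 k_{p,ℓ}(s,t) := f(s−t, (exp((p−i)t)·ℓ₁, exp((−p−iθ)t)·ℓ₂)) and k̃_{δ,p,ℓ}(s,t) := Σ_{j∈ℤ} 1_{I_j}(s)·1_{J_j}(t)·f(s−t, (exp(pR_j − it)·ℓ₁, exp(−pR_j − iθt)·ℓ₂)) respectively. Then lim_{δ→0} sup{ ‖σ_{δ,p,ℓ} − π_{p,ℓ}‖_op : p ∈ [−1,1], |p| ≤ δ, ℓ ∈ ℂ² } = 0. -/
noncomputable section

open MeasureTheory

open Filter Topology in
/-- A continuous compactly supported function on `ℝ × ℂ × ℂ` is uniformly close to its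
precomposition with the hyperbolic dilation `(u, a, b) ↦ (u, exp h * a, exp (-h) * b)`
for small `h`. -/
lemma exists_norm_hyperbolic_dilation_sub_le {f : ℝ × ℂ × ℂ → ℂ} (hf : Continuous f)
    (hsupp : HasCompactSupport f) {C : ℝ} (hC : 0 < C) :
    ∃ κ : ℝ, 0 < κ ∧ ∀ h : ℝ, |h| < κ → ∀ (u : ℝ) (a b : ℂ),
      ‖f (u, a, b) - f (u, Complex.exp (h : ℂ) * a, Complex.exp (-(h : ℂ)) * b)‖ ≤ C := by
  have huc : UniformContinuous f := hsupp.uniformContinuous_of_continuous hf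
  obtain ⟨d, hd, hfd⟩ := Metric.uniformContinuous_iff.1 huc C hC
  obtain ⟨B, hB⟩ := hsupp.isBounded.exists_norm_le
  have hBf : ∀ u a b, f (u, a, b) ≠ 0 → ‖a‖ ≤ max B 1 ∧ ‖b‖ ≤ max B 1 := by
    intro u a b hne
    have h := hB _ (subset_tsupport f hne)
    exact ⟨((norm_fst_le (a, b)).trans (norm_snd_le (u, a, b))).trans (h.trans (le_max_left _ _)),
      ((norm_snd_le (a, b)).trans (norm_snd_le (u, a, b))).trans (h.trans (le_max_left _ _))⟩
  have hM : (0 : ℝ) < max B 1 := lt_max_of_lt_right one_pos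
  have hlim : Tendsto (fun h : ℝ => ‖Complex.exp (h : ℂ) - 1‖) (𝓝 0) (𝓝 0) := by
    have hc : Continuous fun h : ℝ => ‖Complex.exp (h : ℂ) - 1‖ := by fun_prop
    simpa using hc.tendsto 0
  obtain ⟨κ, hκ, hexp⟩ := Metric.eventually_nhds_iff.1 (hlim.eventually_lt_const (div_pos hd hM))
  have hdist : ∀ h : ℝ, |h| < κ → ∀ a : ℂ, ‖a‖ ≤ max B 1 →
      dist a (Complex.exp (h : ℂ) * a) < d := by
    intro h hh a ha
    have h1 : ‖Complex.exp (h : ℂ) - 1‖ < d / max B 1 := hexp (by simpa using hh)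
    have h2 : dist a (Complex.exp (h : ℂ) * a) = ‖Complex.exp (h : ℂ) - 1‖ * ‖a‖ := by
      rw [dist_comm, dist_eq_norm, ← norm_mul]
      congr 1
      ring
    rw [h2]
    calc _ ≤ ‖Complex.exp (h : ℂ) - 1‖ * max B 1 := by gcongr
      _ < d := (lt_div_iff₀ hM).1 h1
  have key : ∀ h : ℝ, |h| < κ → ∀ (u : ℝ) (a b : ℂ), f (u, a, b) ≠ 0 →
      ‖f (u, a, b) - f (u, Complex.exp (h : ℂ) * a, Complex.exp (-(h : ℂ)) * b)‖ ≤ C := by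
    intro h hh u a b hne
    obtain ⟨ha, hb⟩ := hBf u a b hne
    have hb' := hdist (-h) (by simpa using hh) b hb
    rw [← dist_eq_norm]
    refine (hfd ?_).le
    rw [Prod.dist_eq, Prod.dist_eq, dist_self]
    refine max_lt hd (max_lt (hdist h hh a ha) ?_)
    simpa using hb'
  refine ⟨κ, hκ, fun h hh u a b => ?_⟩
  by_cases hne : f (u, a, b) = 0
  · by_cases hne' : f (u, Complex.exp (h : ℂ) * a, Complex.exp (-(h : ℂ)) * b) = 0
    · simp [hne, hne', hC.le]
    · have := key (-h) (by simpa using hh) u _ _ hne'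
      rw [norm_sub_rev]
      simpa [← mul_assoc, ← Complex.exp_add] using this
  · exact key h hh u a b hne

/-- A special case of Young's inequality: the integral of `g` over a window of radius `A`
has `L²` norm at most `2 * A` times that of `g`. -/
lemma lintegral_sq_lintegral_Icc_le {g : ℝ → ENNReal} (hg : Measurable g) (A : ℝ) :
    ∫⁻ s, (∫⁻ t in Set.Icc (s - A) (s + A), g t) ^ (2 : ℝ) ≤
      ENNReal.ofReal (2 * A) ^ (2 : ℝ) * ∫⁻ t, g t ^ (2 : ℝ) := by
  have hvol : ∀ s : ℝ, volume (Set.Icc (s - A) (s + A)) = ENNReal.ofReal (2 * A) := by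
    intro s
    rw [Real.volume_Icc]
    congr 1
    ring
  have hCS : ∀ s : ℝ, (∫⁻ t in Set.Icc (s - A) (s + A), g t) ^ (2 : ℝ) ≤
      ENNReal.ofReal (2 * A) * ∫⁻ t in Set.Icc (s - A) (s + A), g t ^ (2 : ℝ) := by
    intro s
    have h := ENNReal.lintegral_mul_le_Lp_mul_Lq (volume.restrict (Set.Icc (s - A) (s + A)))
      Real.HolderConjugate.two_two (f := fun _ => 1) (g := g) aemeasurable_const hg.aemeasurable
    simp only [Pi.mul_apply, one_mul, ENNReal.one_rpow, lintegral_const,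
      Measure.restrict_apply MeasurableSet.univ, Set.univ_inter, hvol] at h
    calc _ ≤ _ := ENNReal.rpow_le_rpow h (by norm_num)
      _ = _ := by
        rw [ENNReal.mul_rpow_of_nonneg _ _ (by norm_num), ← ENNReal.rpow_mul, ← ENNReal.rpow_mul]
        norm_num
  have hset : MeasurableSet {q : ℝ × ℝ | q.2 ∈ Set.Icc (q.1 - A) (q.1 + A)} := by
    have h1 : MeasurableSet {q : ℝ × ℝ | q.1 - A ≤ q.2} :=
      measurableSet_le (by fun_prop) (by fun_prop)
    have h2 : MeasurableSet {q : ℝ × ℝ | q.2 ≤ q.1 + A} :=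
      measurableSet_le (by fun_prop) (by fun_prop)
    exact h1.inter h2
  calc _ ≤ ∫⁻ s, ENNReal.ofReal (2 * A) * ∫⁻ t in Set.Icc (s - A) (s + A), g t ^ (2 : ℝ) :=
        lintegral_mono hCS
    _ = ENNReal.ofReal (2 * A) * ∫⁻ s, ∫⁻ t in Set.Icc (s - A) (s + A), g t ^ (2 : ℝ) :=
        lintegral_const_mul' _ _ ENNReal.ofReal_ne_top
    _ = ENNReal.ofReal (2 * A) * ∫⁻ s, ∫⁻ t,
          {q : ℝ × ℝ | q.2 ∈ Set.Icc (q.1 - A) (q.1 + A)}.indicator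
            (fun q => g q.2 ^ (2 : ℝ)) (s, t) := by
        congr 1
        refine lintegral_congr fun s => ?_
        rw [← lintegral_indicator measurableSet_Icc]
        rfl
    _ = ENNReal.ofReal (2 * A) * ∫⁻ t, ∫⁻ s,
          {q : ℝ × ℝ | q.2 ∈ Set.Icc (q.1 - A) (q.1 + A)}.indicator
            (fun q => g q.2 ^ (2 : ℝ)) (s, t) := by
        congr 1
        refine lintegral_lintegral_swap (Measurable.aemeasurable ?_)
        exact Measurable.indicator (by fun_prop) hset
    _ = ENNReal.ofReal (2 * A) * ∫⁻ t, g t ^ (2 : ℝ) * ENNReal.ofReal (2 * A) := by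
        congr 1
        refine lintegral_congr fun t => ?_
        rw [← hvol t, ← lintegral_indicator_const measurableSet_Icc]
        refine lintegral_congr fun s => ?_
        simp only [Set.indicator_apply, Set.mem_ofPred_eq, Set.mem_Icc]
        refine if_congr ?_ rfl rfl
        constructor <;> rintro ⟨h1, h2⟩ <;> constructor <;> linarith
    _ = _ := by
        rw [lintegral_mul_const' _ _ ENNReal.ofReal_ne_top, ENNReal.rpow_two]
        ring

/-- A Schur-type test: an operator on `L²(ℝ)` dominated by `C` times the integral over a window of
radius `A` has norm at most `C * (2 * A)`. -/
lemma opNorm_le_of_enorm_le_lintegral_Icc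
    (T : Lp ℂ 2 (volume : Measure ℝ) →L[ℂ] Lp ℂ 2 (volume : Measure ℝ)) {A C : ℝ}
    (hA : 0 ≤ A) (hC : 0 ≤ C)
    (hT : ∀ ξ : Lp ℂ 2 (volume : Measure ℝ), ∀ᵐ s : ℝ,
      ‖T ξ s‖ₑ ≤ ∫⁻ t in Set.Icc (s - A) (s + A), ENNReal.ofReal C * ‖ξ t‖ₑ) :
    ‖T‖ ≤ C * (2 * A) := by
  refine T.opNorm_le_bound (by positivity) fun ξ => ?_
  have hpow : ∀ g : ℝ → ℂ, eLpNorm g 2 volume ^ (2 : ℝ) = ∫⁻ t, ‖g t‖ₑ ^ (2 : ℝ) := fun g => by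
    simpa using eLpNorm_nnreal_pow_eq_lintegral (f := g) (μ := volume) (p := 2) two_ne_zero
  have hmeas : Measurable fun t => ‖ξ t‖ₑ := (Lp.stronglyMeasurable ξ).enorm
  have hle : eLpNorm (T ξ) 2 volume ≤
      ENNReal.ofReal (C * (2 * A)) * eLpNorm ξ 2 volume := by
    rw [← ENNReal.rpow_le_rpow_iff (z := 2) (by norm_num),
      ENNReal.mul_rpow_of_nonneg _ _ (by norm_num), hpow, hpow, ENNReal.ofReal_mul hC]
    calc _ ≤ ∫⁻ s, (∫⁻ t in Set.Icc (s - A) (s + A), ENNReal.ofReal C * ‖ξ t‖ₑ) ^ (2 : ℝ) := by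
          refine lintegral_mono_ae ?_
          filter_upwards [hT ξ] with s hs
          exact ENNReal.rpow_le_rpow hs (by norm_num)
      _ ≤ _ := lintegral_sq_lintegral_Icc_le (hmeas.const_mul _) A
      _ = _ := by
          simp only [ENNReal.mul_rpow_of_nonneg _ _ (zero_le_two (α := ℝ))]
          rw [lintegral_const_mul _ (hmeas.pow_const _)]
          ring
  rw [Lp.norm_def, Lp.norm_def, ← ENNReal.toReal_ofReal (show 0 ≤ C * (2 * A) by positivity),
    ← ENNReal.toReal_mul]
  exact ENNReal.toReal_mono (ENNReal.mul_ne_top ENNReal.ofReal_ne_top (Lp.eLpNorm_ne_top ξ)) hle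

/-- A continuous compactly supported function times an `L²` function is integrable. -/
lemma integrable_mul_Lp_two_of_hasCompactSupport {k : ℝ → ℂ} (hk : Continuous k)
    (hsupp : HasCompactSupport k) (ξ : Lp ℂ 2 (volume : Measure ℝ)) :
    Integrable fun t => k t * ξ t :=
  (hk.memLp_of_hasCompactSupport (p := 2) hsupp).integrable_mul (Lp.memLp ξ)

/-- The sum over the half-open blocks `[j / e, (j + 1) / e)` reduces to the block of `s`. -/
lemma tsum_indicator_Ico_div_mul {e : ℝ} (he : 0 < e) (s : ℝ) (F : ℤ → ℂ) :
    ∑' j : ℤ, Set.indicator (Set.Ico ((j : ℝ) / e) (((j : ℝ) + 1) / e)) (fun _ => (1 : ℂ)) s * F j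
      = F ⌊s * e⌋ := by
  have hmem : ∀ j : ℤ, s ∈ Set.Ico ((j : ℝ) / e) (((j : ℝ) + 1) / e) ↔ ⌊s * e⌋ = j := by
    intro j
    rw [Set.mem_Ico, div_le_iff₀ he, lt_div_iff₀ he, Int.floor_eq_iff]
  rw [tsum_eq_single ⌊s * e⌋]
  · rw [Set.indicator_of_mem ((hmem _).2 rfl), one_mul]
  · intro j hj
    rw [Set.indicator_of_notMem (fun h => hj ((hmem j).1 h).symm), zero_mul]

/-- Proposition 4.1 of the paper for `f = F̂²` smooth and compactly supported: the block
approximation `σ_{δ,p,ℓ}` (with blocks `I_j = [R_j, R_{j+1})`, `J_j = [R_j−r(δ), R_{j+1}+r(δ)]`,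
`R_j = j/ε(δ)`, and frozen kernel at `R_j`) converges to `π_{p,ℓ}` in operator norm,
uniformly in `ℓ ∈ ℂ²` and `|p| ≤ δ`, as `δ → 0`. -/
theorem stmt8 (θ : ℝ) (f : ℝ × ℂ × ℂ → ℂ) (hf : ContDiff ℝ (⊤ : ℕ∞) f)
    (hsupp : HasCompactSupport f) (ε r : ℝ → ℝ)
    (hε : ∀ δ : ℝ, 0 < δ → δ ≤ 1 → 0 < ε δ)
    (hrpos : ∀ δ : ℝ, 0 < δ → δ ≤ 1 → 0 < r δ)
    (h1 : Filter.Tendsto (fun δ : ℝ => δ / ε δ) (nhdsWithin 0 (Set.Ioc 0 1)) (nhds 0))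
    (h2 : Filter.Tendsto r (nhdsWithin 0 (Set.Ioc 0 1)) Filter.atTop)
    (h3 : Filter.Tendsto (fun δ : ℝ => r δ * ε δ) (nhdsWithin 0 (Set.Ioc 0 1)) (nhds 0))
    (π : ℝ → ℂ × ℂ → (Lp ℂ 2 (volume : Measure ℝ) →L[ℂ] Lp ℂ 2 (volume : Measure ℝ)))
    (σ : ℝ → ℝ → ℂ × ℂ →
      (Lp ℂ 2 (volume : Measure ℝ) →L[ℂ] Lp ℂ 2 (volume : Measure ℝ)))
    (hπ : ∀ (p : ℝ) (ℓ : ℂ × ℂ) (ξ : Lp ℂ 2 (volume : Measure ℝ)),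
      (π p ℓ ξ : ℝ → ℂ) =ᵐ[volume] fun s : ℝ =>
        ∫ t : ℝ,
          f (s - t, Complex.exp (((p : ℂ) - Complex.I) * (t : ℂ)) * ℓ.1,
            Complex.exp ((-(p : ℂ) - Complex.I * (θ : ℂ)) * (t : ℂ)) * ℓ.2) * ξ t)
    (hσ : ∀ δ : ℝ, 0 < δ → δ ≤ 1 →
      ∀ (p : ℝ) (ℓ : ℂ × ℂ) (ξ : Lp ℂ 2 (volume : Measure ℝ)),
      (σ δ p ℓ ξ : ℝ → ℂ) =ᵐ[volume] fun s : ℝ =>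
        ∫ t : ℝ,
          (∑' j : ℤ,
            Set.indicator (Set.Ico ((j : ℝ) / ε δ) (((j : ℝ) + 1) / ε δ))
                (fun _ => (1 : ℂ)) s *
              Set.indicator
                (Set.Icc ((j : ℝ) / ε δ - r δ) (((j : ℝ) + 1) / ε δ + r δ))
                (fun _ => (1 : ℂ)) t *
              f (s - t,
                Complex.exp ((p : ℂ) * (((j : ℝ) / ε δ : ℝ) : ℂ) - Complex.I * (t : ℂ)) * ℓ.1,
                Complex.exp (-(p : ℂ) * (((j : ℝ) / ε δ : ℝ) : ℂ) -
                  Complex.I * (θ : ℂ) * (t : ℂ)) * ℓ.2)) * ξ t) :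
    ∀ η : ℝ, 0 < η → ∃ δ₀ : ℝ, 0 < δ₀ ∧
      ∀ δ : ℝ, 0 < δ → δ ≤ 1 → δ < δ₀ →
        ∀ p : ℝ, |p| ≤ δ → ∀ ℓ : ℂ × ℂ, ‖σ δ p ℓ - π p ℓ‖ < η := by
  intro η hη
  have hfc : Continuous f := hf.continuous
  obtain ⟨B, hB⟩ := hsupp.isBounded.exists_norm_le
  set A : ℝ := max B 1
  have hA : 0 < A := lt_max_of_lt_right one_pos
  have hfA : ∀ (u : ℝ) (z : ℂ × ℂ), A < |u| → f (u, z) = 0 := by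
    intro u z hu
    by_contra hne
    have h := (norm_fst_le (u, z)).trans (hB _ (subset_tsupport f hne))
    exact absurd (h.trans (le_max_left B 1)) (not_le.2 hu)
  obtain ⟨κ, hκ, hκf⟩ := exists_norm_hyperbolic_dilation_sub_le hfc hsupp
    (show 0 < η / (4 * A) by positivity)
  have hid : Filter.Tendsto (fun δ : ℝ => δ * A) (nhdsWithin 0 (Set.Ioc 0 1)) (nhds 0) := by
    have hc : Continuous fun δ : ℝ => δ * A := by fun_prop
    simpa using (hc.tendsto 0).mono_left nhdsWithin_le_nhds
  have hev := (h2.eventually_ge_atTop A).and ((h1.eventually_lt_const (half_pos hκ)).and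
    (hid.eventually_lt_const (half_pos hκ)))
  obtain ⟨δ₀, hδ₀, hball⟩ := Metric.mem_nhdsWithin_iff.1 hev
  refine ⟨δ₀, hδ₀, fun δ hδ hδ1 hδδ₀ p hp ℓ => ?_⟩
  obtain ⟨hr, hδε, hδA⟩ : A ≤ r δ ∧ δ / ε δ < κ / 2 ∧ δ * A < κ / 2 :=
    hball ⟨by simpa [abs_of_pos hδ] using hδδ₀, hδ, hδ1⟩
  have he := hε δ hδ hδ1
  refine lt_of_le_of_lt (opNorm_le_of_enorm_le_lintegral_Icc (A := A) (C := η / (4 * A)) _ hA.le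
    (by positivity) fun ξ => ?_) (?_ : η / (4 * A) * (2 * A) < η)
  swap
  · have : η / (4 * A) * (2 * A) = η / 2 := by
      field_simp
      norm_num
    linarith
  filter_upwards [hπ p ℓ ξ, hσ δ hδ hδ1 p ℓ ξ, Lp.coeFn_sub (σ δ p ℓ ξ) (π p ℓ ξ)]
    with s hsπ hsσ hsub
  rw [_root_.sub_apply, hsub, Pi.sub_apply, hsπ, hsσ]
  set R : ℝ := (⌊s * ε δ⌋ : ℝ) / ε δ with hR
  have hRs : R ≤ s := by
    rw [hR, div_le_iff₀ he]
    exact Int.floor_le _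
  have hsR : s < R + 1 / ε δ := by
    rw [hR, ← add_div, lt_div_iff₀ he]
    exact Int.lt_floor_add_one _
  have hblock : ∀ t : ℝ,
      (∑' j : ℤ,
        Set.indicator (Set.Ico ((j : ℝ) / ε δ) (((j : ℝ) + 1) / ε δ)) (fun _ => (1 : ℂ)) s *
          Set.indicator (Set.Icc ((j : ℝ) / ε δ - r δ) (((j : ℝ) + 1) / ε δ + r δ))
            (fun _ => (1 : ℂ)) t *
          f (s - t,
            Complex.exp ((p : ℂ) * (((j : ℝ) / ε δ : ℝ) : ℂ) - Complex.I * (t : ℂ)) * ℓ.1,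
            Complex.exp (-(p : ℂ) * (((j : ℝ) / ε δ : ℝ) : ℂ) -
              Complex.I * (θ : ℂ) * (t : ℂ)) * ℓ.2)) =
      f (s - t, Complex.exp ((p : ℂ) * (R : ℂ) - Complex.I * (t : ℂ)) * ℓ.1,
        Complex.exp (-(p : ℂ) * (R : ℂ) - Complex.I * (θ : ℂ) * (t : ℂ)) * ℓ.2) := by
    intro t
    simp only [mul_assoc (Set.indicator (Set.Ico _ _) _ s)]
    rw [tsum_indicator_Ico_div_mul he s]
    by_cases hst : |s - t| ≤ A
    · rw [Set.indicator_of_mem, one_mul]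
      rw [abs_le] at hst
      rw [add_div]
      constructor <;> linarith
    · simp only [hfA _ _ (not_le.1 hst), mul_zero]
  have hint : ∀ g : ℝ → ℂ × ℂ, Continuous g → Integrable fun t => f (s - t, g t) * ξ t := by
    intro g hg
    refine integrable_mul_Lp_two_of_hasCompactSupport (by fun_prop) ?_ ξ
    refine HasCompactSupport.intro (isCompact_Icc (a := s - A) (b := s + A)) fun t ht => ?_
    refine hfA _ _ (not_le.1 fun h => ht ?_)
    rw [abs_le] at h
    constructor <;> linarith
  simp only [hblock]
  rw [← integral_sub (hint _ (by fun_prop)) (hint _ (by fun_prop)),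
    ← lintegral_indicator measurableSet_Icc]
  refine (enorm_integral_le_lintegral_enorm _).trans (lintegral_mono fun t => ?_)
  rw [← sub_mul]
  by_cases hst : |s - t| ≤ A
  · have hst' := abs_le.1 hst
    rw [Set.indicator_of_mem (by constructor <;> linarith), enorm_mul]
    gcongr
    rw [← ofReal_norm]
    refine ENNReal.ofReal_le_ofReal ?_
    have hh : |p * (t - R)| < κ := by
      have htR : |t - R| ≤ 1 / ε δ + A := by
        have := one_div_pos.2 he
        rw [abs_le]
        constructor <;> linarith
      calc |p * (t - R)| = |p| * |t - R| := abs_mul _ _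
        _ ≤ δ * (1 / ε δ + A) := by gcongr
        _ = δ / ε δ + δ * A := by ring
        _ < κ := by linarith
    have hexp₁ : Complex.exp (((p : ℂ) - Complex.I) * (t : ℂ)) =
        Complex.exp ((p * (t - R) : ℝ) : ℂ) *
          Complex.exp ((p : ℂ) * (R : ℂ) - Complex.I * (t : ℂ)) := by
      rw [← Complex.exp_add]
      congr 1
      push_cast
      ring
    have hexp₂ : Complex.exp ((-(p : ℂ) - Complex.I * (θ : ℂ)) * (t : ℂ)) =
        Complex.exp (-((p * (t - R) : ℝ) : ℂ)) *
          Complex.exp (-(p : ℂ) * (R : ℂ) - Complex.I * (θ : ℂ) * (t : ℂ)) := by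
      rw [← Complex.exp_add]
      congr 1
      push_cast
      ring
    rw [hexp₁, hexp₂, mul_assoc _ _ ℓ.1, mul_assoc _ _ ℓ.2]
    exact hκf _ hh _ _ _
  · rw [hfA _ _ (not_le.1 hst), hfA _ _ (not_le.1 hst)]
    simp


end
end

section
/- Fix θ ∈ ℝ and p ∈ [−1,1]. For continuous compactly supported ξ : ℝ × ℂ² → ℂ define ξ̂(s,ℓ) := ∫_{ℂ²} ξ(s,c)·exp(2πi⟨c,ℓ⟩) dc, and for ℓ ∈ ℂ² define the unitary operator π̃^p_ℓ(t,c) on L²(ℝ) by (π̃^p_ℓ(t,c)η)(s) := exp(2πi⟨(s−t)·_p c, ℓ⟩)·η(s−t). Then for every m = (t,c) ∈ M and all continuous compactly supported ξ, η : ℝ × ℂ² → ℂ: ∫_{ℝ×ℂ²} ξ(m^{−1_p} ·_p x)·conj(η(x)) dx = ∫_{ℂ²} ( ∫_ℝ (π̃^p_ℓ(t,c)(ξ̂(·,ℓ)))(s)·conj(η̂(s,ℓ)) ds ) dℓ, where m^{−1_p} denotes the inverse of m in the group M_p. (This expresses the disintegration of the left regular representation Λ^p as the direct integral ∮_{ℂ²}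 π̃^p_ℓ dℓ.) -/
noncomputable section

open MeasureTheory

/-- The inverse in the variable Mautner group `M_p`. -/
def vinv (θ p : ℝ) (x : ℝ × ℂ × ℂ) : ℝ × ℂ × ℂ :=
  (-x.1,
   -(Complex.exp (-((p : ℂ) + Complex.I) * (x.1 : ℂ)) * x.2.1),
   -(Complex.exp (-(-(p : ℂ) + Complex.I * (θ : ℂ)) * (x.1 : ℂ)) * x.2.2))

/-- The `2π`-normalized partial Fourier transform
`ξ̂(s,ℓ) = ∫_{ℂ²} ξ(s,c) e^{2πi⟨c,ℓ⟩} dc`. -/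
def hat (ξ : ℝ × ℂ × ℂ → ℂ) (s : ℝ) (ℓ : ℂ × ℂ) : ℂ :=
  ∫ c : ℂ × ℂ,
    ξ (s, c) * Complex.exp (((2 * Real.pi : ℝ) : ℂ) * Complex.I * ((cpair c ℓ : ℝ) : ℂ))

open scoped FourierTransform InnerProductSpace ContDiff

section Plancherel

variable {E : Type*} [NormedAddCommGroup E] [InnerProductSpace ℝ E] [FiniteDimensional ℝ E]
  [MeasurableSpace E] [BorelSpace E]

/-- On `L¹ ∩ L²` the `L²`-Fourier transform agrees almost everywhere with the Fourier integral. -/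
theorem coeFn_fourier_toLp_ae_eq {f : E → ℂ} (hf : Integrable f) (hf2 : MemLp f 2) :
    ((𝓕 (hf2.toLp f) : Lp (α := E) ℂ 2) : E → ℂ) =ᵐ[volume] 𝓕 f := by
  have hcont : Continuous (𝓕 f) :=
    VectorFourier.fourierIntegral_continuous Real.continuous_fourierChar
      (innerSL ℝ).continuous₂ hf
  refine ae_eq_of_integral_contDiff_smul_eq ((Lp.memLp _).locallyIntegrable one_le_two)
    hcont.locallyIntegrable fun g g_smooth g_cpt => ?_
  have hg₁ : HasCompactSupport (Complex.ofRealCLM ∘ g) := g_cpt.comp_left rfl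
  have hg₂ : ContDiff ℝ ∞ (Complex.ofRealCLM ∘ g) := by fun_prop
  set φ := hg₁.toSchwartzMap hg₂
  have key := congrArg (fun T : TemperedDistribution E ℂ => T φ)
    (Lp.fourier_toTemperedDistribution_eq (hf2.toLp f))
  simp only [TemperedDistribution.fourier_apply, Lp.toTemperedDistribution_apply] at key
  have hflip : ∫ x, 𝓕 f x • φ x = ∫ x, f x • 𝓕 (φ : E → ℂ) x := by
    simpa using! VectorFourier.integral_fourierIntegral_smul_eq_flip (L := innerₗ E)
      Real.continuous_fourierChar continuous_inner hf φ.integrable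
  have hφ : ∀ x, φ x = (g x : ℂ) := fun x => rfl
  calc ∫ x, g x • (𝓕 (hf2.toLp f) : Lp (α := E) ℂ 2 volume) x
      = ∫ x, φ x • (𝓕 (hf2.toLp f) : Lp (α := E) ℂ 2 volume) x := by simp [hφ]
    _ = ∫ x, (𝓕 φ) x • hf2.toLp f x := key.symm
    _ = ∫ x, f x • 𝓕 (φ : E → ℂ) x := by
        refine integral_congr_ae ?_
        filter_upwards [hf2.coeFn_toLp] with x hx
        rw [hx, SchwartzMap.fourier_coe, smul_eq_mul, smul_eq_mul, mul_comm]
    _ = ∫ x, g x • 𝓕 f x := by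
        rw [← hflip]
        simp [hφ, mul_comm]

theorem memLp_two_fourier {f : E → ℂ} (hf : Integrable f) (hf2 : MemLp f 2) :
    MemLp (𝓕 f) 2 :=
  (memLp_congr_ae (coeFn_fourier_toLp_ae_eq hf hf2)).1 (Lp.memLp _)

/-- Parseval's identity on `L¹ ∩ L²`. -/
theorem integral_fourier_mul_conj_fourier {f g : E → ℂ} (hf : Integrable f) (hf2 : MemLp f 2)
    (hg : Integrable g) (hg2 : MemLp g 2) :
    ∫ w, 𝓕 f w * (starRingEnd ℂ) (𝓕 g w) = ∫ v, f v * (starRingEnd ℂ) (g v) := by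
  have key := Lp.inner_fourier_eq (hg2.toLp g) (hf2.toLp f)
  simp only [L2.inner_def, RCLike.inner_apply] at key
  calc ∫ w, 𝓕 f w * (starRingEnd ℂ) (𝓕 g w) = _ := ?_
    _ = _ := key
    _ = _ := ?_
  · refine integral_congr_ae ?_
    filter_upwards [coeFn_fourier_toLp_ae_eq hf hf2, coeFn_fourier_toLp_ae_eq hg hg2]
      with x hx hy
    rw [hx, hy]
  · refine integral_congr_ae ?_
    filter_upwards [hf2.coeFn_toLp, hg2.coeFn_toLp] with x hx hy
    rw [hx, hy]

end Plancherel

/-- `ξ̂(s,·)` as a Fourier transform on the Euclidean space underlying `ℂ²`. -/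
theorem hat_eq_fourier (ξ : ℝ × ℂ × ℂ → ℂ) (s : ℝ) (ℓ : ℂ × ℂ) :
    hat ξ s ℓ =
      𝓕 (fun v : WithLp 2 (ℂ × ℂ) => ξ (s, WithLp.ofLp (-v))) (WithLp.toLp 2 ℓ) := by
  rw [← Real.fourierInv_eq_fourier_comp_neg (fun v : WithLp 2 (ℂ × ℂ) => ξ (s, WithLp.ofLp v)),
    Real.fourierInv_eq',
    ← (WithLp.volume_preserving_toLp ℂ ℂ).integral_comp
      (MeasurableEquiv.toLp 2 (ℂ × ℂ)).measurableEmbedding, hat]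
  refine integral_congr_ae (.of_forall fun c => ?_)
  have : cpair c ℓ = inner ℝ (WithLp.toLp 2 c) (WithLp.toLp 2 ℓ) := by
    simp [cpair, Complex.inner]
    ring
  simp only [this, smul_eq_mul]
  rw [mul_comm]
  congr 2
  push_cast
  ring

section

variable {ξ η : ℝ × ℂ × ℂ → ℂ}

theorem continuous_slice (hξ : Continuous ξ) (s : ℝ) :
    Continuous fun v : WithLp 2 (ℂ × ℂ) => ξ (s, WithLp.ofLp (-v)) := by
  fun_prop

theorem hasCompactSupport_slice (hξs : HasCompactSupport ξ) (s : ℝ) :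
    HasCompactSupport fun v : WithLp 2 (ℂ × ℂ) => ξ (s, WithLp.ofLp (-v)) := by
  refine .intro (hξs.isCompact.image (f := fun x : ℝ × ℂ × ℂ => -WithLp.toLp 2 x.2)
    (by fun_prop)) fun v hv => ?_
  exact image_eq_zero_of_notMem_tsupport fun h => hv ⟨_, h, by simp⟩

theorem memLp_hat (hξ : Continuous ξ) (hξs : HasCompactSupport ξ) (s : ℝ) :
    MemLp (hat ξ s) 2 := by
  have hc := continuous_slice hξ s
  have hs := hasCompactSupport_slice hξs s
  have := (memLp_two_fourier (hc.integrable_of_hasCompactSupport hs)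
    (hc.memLp_of_hasCompactSupport hs)).comp_measurePreserving
      (WithLp.volume_preserving_toLp ℂ ℂ)
  rwa [show hat ξ s = _ from funext (hat_eq_fourier ξ s)]

theorem integral_hat_mul_conj_hat (hξ : Continuous ξ) (hξs : HasCompactSupport ξ)
    (hη : Continuous η) (hηs : HasCompactSupport η) (s : ℝ) :
    ∫ ℓ, hat ξ s ℓ * (starRingEnd ℂ) (hat η s ℓ) =
      ∫ c, ξ (s, c) * (starRingEnd ℂ) (η (s, c)) := by
  have hc := continuous_slice hξ s
  have hs := hasCompactSupport_slice hξs s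
  have hc' := continuous_slice hη s
  have hs' := hasCompactSupport_slice hηs s
  have hemb := (MeasurableEquiv.toLp 2 (ℂ × ℂ)).measurableEmbedding
  have key := integral_fourier_mul_conj_fourier (hc.integrable_of_hasCompactSupport hs)
    (hc.memLp_of_hasCompactSupport hs) (hc'.integrable_of_hasCompactSupport hs')
    (hc'.memLp_of_hasCompactSupport hs')
  rw [integral_neg_eq_self
      (fun v : WithLp 2 (ℂ × ℂ) => ξ (s, WithLp.ofLp v) * (starRingEnd ℂ) (η (s, WithLp.ofLp v))),
    ← (WithLp.volume_preserving_toLp ℂ ℂ).integral_comp hemb,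
    ← (WithLp.volume_preserving_toLp ℂ ℂ).integral_comp hemb] at key
  simpa only [hat_eq_fourier] using key

theorem continuous_uncurry_hat (hξ : Continuous ξ) (hξs : HasCompactSupport ξ) :
    Continuous fun x : ℝ × ℂ × ℂ => hat ξ x.1 x.2 := by
  have hK : IsCompact (Prod.snd '' tsupport ξ) := hξs.isCompact.image continuous_snd
  have hpair : Continuous fun q : (ℂ × ℂ) × (ℂ × ℂ) => cpair q.1 q.2 := by
    unfold cpair
    fun_prop
  have := continuous_parametric_integral_of_continuous (μ := volume)
    (f := fun (x : ℝ × ℂ × ℂ) (c : ℂ × ℂ) => ξ (x.1, c) *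
      Complex.exp (((2 * Real.pi : ℝ) : ℂ) * Complex.I * ((cpair c x.2 : ℝ) : ℂ)))
    (by
      have h2 : Continuous fun q : (ℝ × ℂ × ℂ) × (ℂ × ℂ) => cpair q.2 q.1.2 :=
        hpair.comp (continuous_snd.prodMk continuous_fst.snd)
      simp only [Function.uncurry_def]
      fun_prop) hK
  convert this using 2 with x
  refine (setIntegral_eq_integral_of_forall_compl_eq_zero fun c hc => ?_).symm
  rw [image_eq_zero_of_notMem_tsupport fun h => hc ⟨_, h, rfl⟩, zero_mul]

theorem memLp_uncurry_hat (hξ : Continuous ξ) (hξs : HasCompactSupport ξ) :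
    MemLp (fun x : ℝ × ℂ × ℂ => hat ξ x.1 x.2) 2 := by
  have hcont := continuous_uncurry_hat hξ hξs
  rw [memLp_two_iff_integrable_sq_norm hcont.aestronglyMeasurable, Measure.volume_eq_prod,
    integrable_prod_iff (by fun_prop)]
  refine ⟨.of_forall fun s => (memLp_hat hξ hξs s).integrable_norm_pow two_ne_zero, ?_⟩
  have hint : Integrable (fun x => ‖ξ x‖ ^ 2) :=
    (hξ.memLp_of_hasCompactSupport hξs).integrable_norm_pow two_ne_zero
  rw [Measure.volume_eq_prod] at hint
  refine hint.integral_prod_left.congr (.of_forall fun s => ?_)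
  have key := integral_hat_mul_conj_hat hξ hξs hξ hξs s
  simp only [Complex.mul_conj', ← Complex.ofReal_pow, integral_complex_ofReal,
    Complex.ofReal_inj] at key
  simpa using key.symm

/-- Parseval's identity for the partial Fourier transform. -/
theorem integral_mul_conj_eq_integral_hat (hξ : Continuous ξ) (hξs : HasCompactSupport ξ)
    (hη : Continuous η) (hηs : HasCompactSupport η) :
    ∫ x, ξ x * (starRingEnd ℂ) (η x) =
      ∫ ℓ : ℂ × ℂ, ∫ s : ℝ, hat ξ s ℓ * (starRingEnd ℂ) (hat η s ℓ) := by
  have hL : Integrable fun x => ξ x * (starRingEnd ℂ) (η x) :=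
    (hξ.mul (Complex.continuous_conj.comp hη)).integrable_of_hasCompactSupport hξs.mul_right
  have hR : Integrable fun x : ℝ × ℂ × ℂ => hat ξ x.1 x.2 * (starRingEnd ℂ) (hat η x.1 x.2) :=
    (memLp_uncurry_hat hξ hξs).integrable_mul (memLp_uncurry_hat hη hηs).star
  rw [Measure.volume_eq_prod] at hL hR ⊢
  rw [integral_prod _ hL, ← integral_integral_swap
    (f := fun s ℓ => hat ξ s ℓ * (starRingEnd ℂ) (hat η s ℓ)) hR]
  simp only [integral_hat_mul_conj_hat hξ hξs hη hηs]

end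

/-- `(t,c)⁻¹ ·_p (s,d) = (s - t, d - (s - t) ·_p c)`. -/
theorem vmul_vinv (θ p : ℝ) (m x : ℝ × ℂ × ℂ) :
    vmul θ p (vinv θ p m) x = (x.1 - m.1, x.2 - act θ p (x.1 - m.1) m.2) := by
  ext1
  · simp [vmul, vinv]
    ring
  · ext1 <;>
    · simp only [vmul, vinv, act, Prod.fst_sub, Prod.snd_sub, mul_neg, ← mul_assoc,
        ← Complex.exp_add]
      push_cast
      ring_nf

/-- Left translation by `m⁻¹` as a homeomorphism of `M`. -/
def leftTranslation (θ p : ℝ) (m : ℝ × ℂ × ℂ) : (ℝ × ℂ × ℂ) ≃ₜ (ℝ × ℂ × ℂ) where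
  toFun x := (x.1 - m.1, x.2 - act θ p (x.1 - m.1) m.2)
  invFun x := (x.1 + m.1, x.2 + act θ p x.1 m.2)
  left_inv x := by simp
  right_inv x := by simp
  continuous_toFun := by unfold act; fun_prop
  continuous_invFun := by unfold act; fun_prop

theorem hat_comp_leftTranslation (θ p : ℝ) (ξ : ℝ × ℂ × ℂ → ℂ) (m : ℝ × ℂ × ℂ) (s : ℝ)
    (ℓ : ℂ × ℂ) :
    hat (ξ ∘ leftTranslation θ p m) s ℓ =
      Complex.exp (((2 * Real.pi : ℝ) : ℂ) * Complex.I *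
            ((cpair (act θ p (s - m.1) m.2) ℓ : ℝ) : ℂ)) * hat ξ (s - m.1) ℓ := by
  set d := act θ p (s - m.1) m.2
  have hadd : ∀ c, cpair (c + d) ℓ = cpair d ℓ + cpair c ℓ := fun c => by
    simp only [cpair, Prod.fst_add, Prod.snd_add, add_mul, Complex.add_re]
    ring
  have : (volume : Measure (ℂ × ℂ)).IsAddRightInvariant := by
    rw [Measure.volume_eq_prod]
    infer_instance
  rw [hat, hat, ← integral_const_mul,
    ← integral_add_right_eq_self (μ := (volume : Measure (ℂ × ℂ))) _ d]
  refine integral_congr_ae (.of_forall fun c => ?_)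
  have hξ : ξ (leftTranslation θ p m (s, c + d)) = ξ (s - m.1, c) :=
    congrArg (fun c' => ξ (s - m.1, c')) (add_sub_cancel_right c d)
  simp only [Function.comp_apply, hξ, hadd, Complex.ofReal_add, mul_add, Complex.exp_add]
  ring

/-- Disintegration of the left regular representation: for `m = (t,c) ∈ M` and continuous
compactly supported `ξ, η`,
`∫_M ξ(m^{−1_p} ·_p x) conj(η(x)) dx
  = ∫_{ℂ²} ∫_ℝ e^{2πi⟨(s−t)·_p c, ℓ⟩} ξ̂(s−t,ℓ) conj(η̂(s,ℓ)) ds dℓ`,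
i.e. `Λ^p = ∮_{ℂ²} π̃^p_ℓ dℓ`. -/
theorem stmt11 (θ p : ℝ) (hp : p ∈ Set.Icc (-1 : ℝ) 1)
    (ξ η : ℝ × ℂ × ℂ → ℂ) (hξ : Continuous ξ) (hξs : HasCompactSupport ξ)
    (hη : Continuous η) (hηs : HasCompactSupport η) (m : ℝ × ℂ × ℂ) :
    ∫ x : ℝ × ℂ × ℂ, ξ (vmul θ p (vinv θ p m) x) * (starRingEnd ℂ) (η x) =
      ∫ ℓ : ℂ × ℂ, ∫ s : ℝ,
        Complex.exp (((2 * Real.pi : ℝ) : ℂ) * Complex.I *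
            ((cpair (act θ p (s - m.1) m.2) ℓ : ℝ) : ℂ)) *
          hat ξ (s - m.1) ℓ * (starRingEnd ℂ) (hat η s ℓ) := by
  have hτ : Continuous (ξ ∘ leftTranslation θ p m) := hξ.comp (leftTranslation θ p m).continuous
  have := integral_mul_conj_eq_integral_hat hτ (hξs.comp_homeomorph (leftTranslation θ p m)) hη hηs
  simp only [hat_comp_leftTranslation] at this
  rw [← this]
  simp only [vmul_vinv]
  rfl

end
end

section
/- Fix θ ∈ ℝ and let F : ℝ × ℂ² → ℂ be continuous with compact support. For p ∈ [−1,1] and ℓ ∈ ℂ², let π^p_ℓ(F) be the bounded integral operator on L²(ℝ) with kernel (s,t) ↦ F̂²(s−t, t ⊙_p ℓ). Then for every ξ ∈ L²(ℝ), the map [−1,1] × ℂ² → L²(ℝ), (p,ℓ) ↦ π^p_ℓ(F)ξ, is continuous; that is, the operator field (p,ℓ) ↦ π^p_ℓ(F) is strongly continuous. -/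
noncomputable section

open MeasureTheory

lemma continuous_dact (θ : ℝ) :
    Continuous fun x : (ℝ × (ℂ × ℂ)) × ℝ => dact θ x.1.1 x.2 x.1.2 := by
  unfold dact
  fun_prop

lemma pft_eq_setIntegral {F : ℝ × ℂ × ℂ → ℂ} (u : ℝ) (ℓ : ℂ × ℂ) :
    pft F u ℓ = ∫ c in Prod.snd '' tsupport F,
      F (u, c) * Complex.exp (Complex.I * ((cpair c ℓ : ℝ) : ℂ)) := by
  refine (setIntegral_eq_integral_of_forall_compl_eq_zero fun c hc => ?_).symm
  rw [image_eq_zero_of_notMem_tsupport fun h => hc ⟨(u, c), h, rfl⟩, zero_mul]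

lemma continuous_pft {F : ℝ × ℂ × ℂ → ℂ} (hF : Continuous F) (hFs : HasCompactSupport F) :
    Continuous fun x : ℝ × (ℂ × ℂ) => pft F x.1 x.2 := by
  simp only [pft_eq_setIntegral]
  refine continuous_parametric_integral_of_continuous ?_ (hFs.isCompact.image continuous_snd)
  unfold Function.uncurry cpair
  fun_prop

lemma exists_norm_pft_le {F : ℝ × ℂ × ℂ → ℂ} (hF : Continuous F) (hFs : HasCompactSupport F) :
    ∃ M : ℝ, ∀ u ℓ, ‖pft F u ℓ‖ ≤ M := by
  obtain ⟨C, hC⟩ := hFs.exists_bound_of_continuous hF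
  refine ⟨C * volume.real (Prod.snd '' tsupport F), fun u ℓ => ?_⟩
  rw [pft_eq_setIntegral]
  refine norm_setIntegral_le_of_norm_le_const
    (hFs.isCompact.image continuous_snd).measure_lt_top fun c _ => ?_
  rw [norm_mul, mul_comm Complex.I, Complex.norm_exp_ofReal_mul_I, mul_one]
  exact hC _

lemma exists_pft_eq_zero {F : ℝ × ℂ × ℂ → ℂ} (hFs : HasCompactSupport F) :
    ∃ R : ℝ, ∀ u ℓ, u ∉ Metric.closedBall (0 : ℝ) R → pft F u ℓ = 0 := by
  obtain ⟨R, hR⟩ := (hFs.isCompact.image continuous_fst).isBounded.subset_closedBall (0 : ℝ)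
  refine ⟨R, fun u ℓ hu => ?_⟩
  have h (c : ℂ × ℂ) : F (u, c) = 0 :=
    image_eq_zero_of_notMem_tsupport fun h => hu (hR ⟨(u, c), h, rfl⟩)
  simp [pft, h]

/-- Cauchy-Schwarz on a ball. -/
lemma sq_lintegral_closedBall_le {f : ℝ → ℂ} (hf : AEStronglyMeasurable f volume) (R s : ℝ) :
    (∫⁻ t in Metric.closedBall s R, ‖f t‖ₑ) ^ 2 ≤
      ENNReal.ofReal (2 * R) * ∫⁻ t in Metric.closedBall s R, ‖f t‖ₑ ^ 2 := by
  have h := eLpNorm_le_eLpNorm_mul_rpow_measure_univ (p := 1) (q := 2)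
    (μ := volume.restrict (Metric.closedBall s R)) (by norm_num) hf.restrict
  rw [eLpNorm_one_eq_lintegral_enorm, Measure.restrict_apply_univ, Real.volume_closedBall] at h
  refine (pow_le_pow_left' h 2).trans_eq ?_
  rw [mul_pow, mul_comm, eLpNorm_eq_lintegral_rpow_enorm_toReal (by norm_num) (by norm_num),
    ← ENNReal.rpow_natCast, ← ENNReal.rpow_natCast, ← ENNReal.rpow_mul, ← ENNReal.rpow_mul]
  norm_num

lemma lintegral_sq_lintegral_closedBall_lt_top {f : ℝ → ℂ} (hf : MemLp f 2 volume) (R : ℝ) :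
    ∫⁻ s, (∫⁻ t in Metric.closedBall s R, ‖f t‖ₑ) ^ 2 < ⊤ := by
  have hm : AEMeasurable (fun t => ‖f t‖ₑ ^ 2) volume := hf.1.enorm.pow_const 2
  have hfin : ∫⁻ t, ‖f t‖ₑ ^ 2 < ⊤ := by
    have := (eLpNorm_lt_top_iff_lintegral_rpow_enorm_lt_top (by norm_num) (by norm_num)).1 hf.2
    simpa using this
  have hset : MeasurableSet {x : ℝ × ℝ | dist x.2 x.1 ≤ R} :=
    (isClosed_le (by fun_prop) continuous_const).measurableSet
  have hswap : ∫⁻ s, ∫⁻ t in Metric.closedBall s R, ‖f t‖ₑ ^ 2 =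
      ∫⁻ t, ENNReal.ofReal (2 * R) * ‖f t‖ₑ ^ 2 := by
    simp_rw [← lintegral_indicator Metric.isClosed_closedBall.measurableSet]
    rw [lintegral_lintegral_swap]
    · refine lintegral_congr fun t => ?_
      rw [← Real.volume_closedBall t R, mul_comm, ← setLIntegral_const,
        ← lintegral_indicator Metric.isClosed_closedBall.measurableSet]
      refine lintegral_congr fun s => ?_
      simp only [Set.indicator, Metric.mem_closedBall, dist_comm]
    · exact (hm.comp_snd (μ := volume)).indicator hset
  refine (lintegral_mono fun s => sq_lintegral_closedBall_le hf.1 R s).trans_lt ?_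
  rw [lintegral_const_mul' _ _ ENNReal.ofReal_ne_top, hswap,
    lintegral_const_mul' _ _ ENNReal.ofReal_ne_top]
  exact ENNReal.mul_lt_top ENNReal.ofReal_lt_top (ENNReal.mul_lt_top ENNReal.ofReal_lt_top hfin)

/-- Integral operators applied to a fixed `ξ ∈ L²(ℝ)` converge in `L²` when the kernels converge
pointwise, are uniformly bounded, and vanish outside a fixed band around the diagonal. -/
lemma tendsto_Lp_of_tendsto_kernel {K : ℕ → ℝ → ℝ → ℂ} {K₀ : ℝ → ℝ → ℂ} {M R : ℝ}
    (hKm : ∀ n s, AEStronglyMeasurable (K n s) volume)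
    (hKM : ∀ n s t, ‖K n s t‖ ≤ M)
    (hKR : ∀ n s t, t ∉ Metric.closedBall s R → K n s t = 0)
    (hK : ∀ s t, Filter.Tendsto (fun n => K n s t) Filter.atTop (nhds (K₀ s t)))
    (ξ : Lp ℂ 2 (volume : Measure ℝ)) {g : ℕ → Lp ℂ 2 (volume : Measure ℝ)}
    {g₀ : Lp ℂ 2 (volume : Measure ℝ)}
    (hg : ∀ n, g n =ᵐ[volume] fun s => ∫ t, K n s t * ξ t)
    (hg₀ : g₀ =ᵐ[volume] fun s => ∫ t, K₀ s t * ξ t) :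
    Filter.Tendsto g Filter.atTop (nhds g₀) := by
  have hM : 0 ≤ M := (norm_nonneg _).trans (hKM 0 0 0)
  have hle (n : ℕ) (s t : ℝ) : ‖K n s t * ξ t‖ ≤
      (Metric.closedBall s R).indicator (fun t => M * ‖ξ t‖) t := by
    by_cases ht : t ∈ Metric.closedBall s R
    · rw [Set.indicator_of_mem ht, norm_mul]
      gcongr
      exact hKM n s t
    · simp [Set.indicator_of_notMem ht, hKR n s t ht]
  have hint (s : ℝ) : Integrable
      ((Metric.closedBall s R).indicator (fun t => M * ‖ξ t‖)) volume := by
    rw [integrable_indicator_iff Metric.isClosed_closedBall.measurableSet]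
    exact (((Lp.memLp ξ).locallyIntegrable (by norm_num)).integrableOn_isCompact
      (isCompact_closedBall s R)).norm.const_mul M
  have hlim (s : ℝ) : Filter.Tendsto (fun n => ∫ t, K n s t * ξ t) Filter.atTop
      (nhds (∫ t, K₀ s t * ξ t)) :=
    tendsto_integral_of_dominated_convergence _
      (fun n => (hKm n s).mul (Lp.aestronglyMeasurable ξ)) (hint s)
      (fun n => Filter.Eventually.of_forall (hle n s))
      (Filter.Eventually.of_forall fun t => (hK s t).mul_const _)
  set B : ℝ → ENNReal := fun s =>
    ENNReal.ofReal M * ∫⁻ t in Metric.closedBall s R, ‖ξ t‖ₑ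
  have hB (n : ℕ) (s : ℝ) : ‖∫ t, K n s t * ξ t‖ₑ ≤ B s := by
    refine (enorm_integral_le_lintegral_enorm _).trans ?_
    simp only [B]
    rw [← lintegral_const_mul' _ _ ENNReal.ofReal_ne_top,
      ← lintegral_indicator Metric.isClosed_closedBall.measurableSet]
    refine lintegral_mono fun t => ?_
    by_cases ht : t ∈ Metric.closedBall s R
    · rw [Set.indicator_of_mem ht, enorm_mul]
      gcongr
      rw [← ofReal_norm]
      exact ENNReal.ofReal_le_ofReal (hKM n s t)
    · simp [Set.indicator_of_notMem ht, hKR n s t ht]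
  have hB₀ (s : ℝ) : ‖∫ t, K₀ s t * ξ t‖ₑ ≤ B s :=
    le_of_tendsto (hlim s).enorm (Filter.Eventually.of_forall fun n => hB n s)
  have hsq : Filter.Tendsto (fun n => ∫⁻ s, ‖g n s - g₀ s‖ₑ ^ 2) Filter.atTop (nhds 0) := by
    rw [← lintegral_zero (μ := (volume : Measure ℝ))]
    refine tendsto_lintegral_of_dominated_convergence' (fun s => (2 * B s) ^ 2)
      (fun n => ((Lp.aestronglyMeasurable (g n)).sub
        (Lp.aestronglyMeasurable g₀)).enorm.pow_const 2) (fun n => ?_) ?_ ?_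
    · filter_upwards [hg n, hg₀] with s h h₀
      rw [h, h₀, two_mul]
      gcongr
      exact enorm_sub_le.trans (add_le_add (hB n s) (hB₀ s))
    · simp only [B, mul_pow]
      rw [lintegral_const_mul' _ _ (by norm_num),
        lintegral_const_mul' _ _ (ENNReal.pow_ne_top ENNReal.ofReal_ne_top)]
      exact ENNReal.mul_ne_top (by norm_num) (ENNReal.mul_ne_top
        (ENNReal.pow_ne_top ENNReal.ofReal_ne_top)
        (lintegral_sq_lintegral_closedBall_lt_top (Lp.memLp ξ) R).ne)
    · filter_upwards [ae_all_iff.2 hg, hg₀] with s h h₀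
      simp only [h, h₀]
      have := ((hlim s).sub_const (∫ t, K₀ s t * ξ t)).enorm
      rw [sub_self, enorm_zero] at this
      simpa using ENNReal.Tendsto.pow (n := 2) this
  rw [Lp.tendsto_Lp_iff_tendsto_eLpNorm']
  have heq (n : ℕ) : eLpNorm (⇑(g n) - ⇑g₀) 2 volume =
      (∫⁻ s, ‖g n s - g₀ s‖ₑ ^ 2) ^ (1 / 2 : ℝ) := by
    rw [eLpNorm_eq_lintegral_rpow_enorm_toReal (by norm_num) (by norm_num)]
    simp
  simp only [heq]
  simpa using hsq.ennrpow_const (1 / 2 : ℝ)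

/-- Strong continuity of the operator field: for `F` continuous with compact support and
`π^p_ℓ(F)` the integral operator with kernel `(s,t) ↦ F̂²(s−t, t ⊙_p ℓ)`, the map
`(p,ℓ) ↦ π^p_ℓ(F)ξ` is continuous on `[−1,1] × ℂ²` for every `ξ ∈ L²(ℝ)`. -/
theorem stmt14 (θ : ℝ) (F : ℝ × ℂ × ℂ → ℂ) (hF : Continuous F)
    (hFs : HasCompactSupport F)
    (π : ℝ → ℂ × ℂ → (Lp ℂ 2 (volume : Measure ℝ) →L[ℂ] Lp ℂ 2 (volume : Measure ℝ)))
    (hπ : ∀ p ∈ Set.Icc (-1 : ℝ) 1, ∀ (ℓ : ℂ × ℂ) (ξ : Lp ℂ 2 (volume : Measure ℝ)),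
      (π p ℓ ξ : ℝ → ℂ) =ᵐ[volume]
        fun s : ℝ => ∫ t : ℝ, pft F (s - t) (dact θ p t ℓ) * ξ t) :
    ∀ ξ : Lp ℂ 2 (volume : Measure ℝ),
      ContinuousOn (fun q : ℝ × (ℂ × ℂ) => π q.1 q.2 ξ)
        (Set.Icc (-1 : ℝ) 1 ×ˢ (Set.univ : Set (ℂ × ℂ))) := by
  intro ξ
  obtain ⟨M, hM⟩ := exists_norm_pft_le hF hFs
  obtain ⟨R, hR⟩ := exists_pft_eq_zero hFs
  have hcont : Continuous fun x : (ℝ × (ℂ × ℂ)) × ℝ × ℝ =>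
      pft F (x.2.1 - x.2.2) (dact θ x.1.1 x.2.2 x.1.2) :=
    (continuous_pft hF hFs).comp (((by fun_prop : Continuous fun x : (ℝ × (ℂ × ℂ)) × ℝ × ℝ =>
      x.2.1 - x.2.2)).prodMk ((continuous_dact θ).comp
        (by fun_prop : Continuous fun x : (ℝ × (ℂ × ℂ)) × ℝ × ℝ => (x.1, x.2.2))))
  rw [continuousOn_iff_continuous_domRestrict, continuous_iff_seqContinuous]
  intro q q₀ hq
  refine tendsto_Lp_of_tendsto_kernel
    (K := fun n s t => pft F (s - t) (dact θ (q n).1.1 t (q n).1.2)) (M := M) (R := R)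
    (fun n s => ?_) (fun n s t => hM _ _) (fun n s t ht => hR _ _ ?_) (fun s t => ?_) ξ
    (fun n => hπ _ (q n).2.1 _ ξ) (hπ _ q₀.2.1 _ ξ)
  · exact (hcont.comp (by fun_prop :
      Continuous fun t : ℝ => ((q n).1, s, t))).aestronglyMeasurable
  · rwa [mem_closedBall_zero_iff, ← dist_eq_norm, dist_comm, ← Metric.mem_closedBall]
  · exact ((hcont.comp (by fun_prop :
      Continuous fun y : ℝ × (ℂ × ℂ) => (y, s, t))).tendsto q₀.1).comp
        ((continuous_subtype_val.tendsto q₀).comp hq)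

end
end
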